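/- arXiv:1404.6585 — 3 statements merged into one kernel-verified Lean document; each statement's English description precedes it below -/
import Mathlib

section
/- Fix δ ∈ (0,1) and η ∈ (0,1]. There exists N (depending only on δ and |𝒴|) such that for every n ≥ N and every nonempty A ⊆ 𝒳ⁿ the following holds. Let {B_k}_{k=0}^{K_δ} be the δ-information-spectrum partition of 𝒴ⁿ w.r.t. the information spectrum of P_A and set η_{k} = P_A(⋃_{l=0}^{k} B_l). Then there exists k′ ∈ [0, K_δ] (namely the minimal index with η ≤ η_{k′}) such that (1/n)·log₂ ḡⁿ(A,η) ≤ (1/n)·log₂|⋃_{k=0}^{k′} B_k| ≤ (k′+2)δ; and if moreover k′ ≥ 1 and P_A(B_{k′−1}) > 2^{−nδ}, then (1/n)·log₂ ḡⁿ(A,η) ≥ (1/n)·log₂|B_{k′−1}| ≥ (k′−2)δ. -/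
open scoped BigOperators Classical
open Finset Real

noncomputable section

/-- The `n`-fold product channel: `Wⁿ(yⁿ|xⁿ) = ∏ⱼ W(yⱼ|xⱼ)`. -/
def prodW {X Y : Type*} (W : X → Y → ℝ) {n : ℕ} (x : Fin n → X) (y : Fin n → Y) : ℝ :=
  ∏ j, W (x j) (y j)

/-- Probability `Wⁿ(B|xⁿ)` of an output set `B` given input `xⁿ`. -/
def prodWSet {X Y : Type*} (W : X → Y → ℝ) {n : ℕ} (x : Fin n → X)
    (B : Finset (Fin n → Y)) : ℝ :=
  ∑ y ∈ B, prodW W x y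

/-- Output distribution `P_A` of `Wⁿ` with uniformly distributed input on `A`. -/
def outDist {X Y : Type*} (W : X → Y → ℝ) {n : ℕ}
    (A : Finset (Fin n → X)) (y : Fin n → Y) : ℝ :=
  (A.card : ℝ)⁻¹ * ∑ x ∈ A, prodW W x y

/-- `W` is a channel: each row is a probability distribution on `Y`. -/
def isChannel {X Y : Type*} [Fintype Y] (W : X → Y → ℝ) : Prop :=
  ∀ x, (∀ y, 0 ≤ W x y) ∧ ∑ y, W x y = 1

/-- `K_δ = ⌈(log₂ |𝒴|)/δ⌉`. -/
def Kdel (c : ℕ) (δ : ℝ) : ℕ := ⌈Real.logb 2 c / δ⌉₊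

/-- The sets `B_k` of the `δ`-information-spectrum partition of `𝒴ⁿ` w.r.t. the
information spectrum `i_n(yⁿ) = -(1/n) log₂ p(yⁿ)`:  membership `kδ ≤ i_n(yⁿ) < (k+1)δ`
(resp. `Kδ ≤ i_n(yⁿ) < ∞` for `k = K`) is expressed directly in terms of `p`. -/
def specSet {Y : Type*} [Fintype Y] {n : ℕ} (p : (Fin n → Y) → ℝ)
    (δ : ℝ) (K k : ℕ) : Finset (Fin n → Y) :=
  if k < K then
    Finset.univ.filter fun y =>
      (2:ℝ) ^ (-((n:ℝ) * ((k:ℝ)+1) * δ)) < p y ∧ p y ≤ (2:ℝ) ^ (-((n:ℝ) * (k:ℝ) * δ))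
  else
    Finset.univ.filter fun y => 0 < p y ∧ p y ≤ (2:ℝ) ^ (-((n:ℝ) * (K:ℝ) * δ))

/-- `ḡⁿ(A,η)`: minimum cardinality of an `η`-quasi-image of `A` over `Wⁿ`. -/
def gbar {X Y : Type*} [Fintype Y] (W : X → Y → ℝ) {n : ℕ}
    (A : Finset (Fin n → X)) (η : ℝ) : ℕ :=
  sInf {m | ∃ B : Finset (Fin n → Y), B.card = m ∧ η ≤ ∑ y ∈ B, outDist W A y}

/-- `gⁿ(A,η)`: minimum cardinality of an `η`-image of `A` over `Wⁿ`. -/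
def gimg {X Y : Type*} [Fintype Y] (W : X → Y → ℝ) {n : ℕ}
    (A : Finset (Fin n → X)) (η : ℝ) : ℕ :=
  sInf {m | ∃ B : Finset (Fin n → Y), B.card = m ∧ ∀ x ∈ A, η ≤ prodWSet W x B}

/-- Shannon entropy (base 2) of a distribution `q` on a finite set. -/
def ent {Z : Type*} [Fintype Z] (q : Z → ℝ) : ℝ :=
  -∑ z, q z * Real.logb 2 (q z)

end

/-- Union `⋃_{l=0}^{k} B_l` of the first `k+1` sets of the partition. -/
noncomputable def cumSpec {Y : Type*} [Fintype Y] {n : ℕ} (p : (Fin n → Y) → ℝ)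
    (δ : ℝ) (K k : ℕ) : Finset (Fin n → Y) :=
  (Finset.range (k + 1)).biUnion fun l => specSet p δ K l

theorem prodW_nonneg {X Y : Type*} [Fintype Y] {W : X → Y → ℝ} (hW : isChannel W) {n : ℕ}
    (x : Fin n → X) (y : Fin n → Y) : 0 ≤ prodW W x y :=
  Finset.prod_nonneg fun j _ => (hW (x j)).1 (y j)

theorem sum_prodW {X Y : Type*} [Fintype Y] {W : X → Y → ℝ} (hW : isChannel W) {n : ℕ}
    (x : Fin n → X) : ∑ y, prodW W x y = 1 := by
  have h := Finset.prod_univ_sum (fun _ : Fin n => (Finset.univ : Finset Y))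
    (fun j y => W (x j) y)
  simp only [Fintype.piFinset_univ, (hW _).2, Finset.prod_const_one] at h
  exact h.symm

theorem outDist_nonneg {X Y : Type*} [Fintype Y] {W : X → Y → ℝ} (hW : isChannel W) {n : ℕ}
    (A : Finset (Fin n → X)) (y : Fin n → Y) : 0 ≤ outDist W A y :=
  mul_nonneg (by positivity) (Finset.sum_nonneg fun x _ => prodW_nonneg hW x y)

theorem sum_outDist {X Y : Type*} [Fintype Y] {W : X → Y → ℝ} (hW : isChannel W) {n : ℕ}
    {A : Finset (Fin n → X)} (hA : A.Nonempty) : ∑ y, outDist W A y = 1 := by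
  have hc : (A.card : ℝ) ≠ 0 := by exact_mod_cast hA.card_pos.ne'
  simp only [outDist]
  rw [← Finset.mul_sum, Finset.sum_comm]
  simp [sum_prodW hW, hc]

/-- The elements of weight above a threshold maximise the total weight among all sets of at most
the same size. -/
theorem card_filter_lt_of_sum_lt {ι : Type*} [Fintype ι] {p : ι → ℝ} {t : ℝ} (ht : 0 ≤ t)
    {B T : Finset ι} (hT : ∀ y, y ∈ T ↔ t < p y) (h : ∑ y ∈ T, p y < ∑ y ∈ B, p y) :
    T.card < B.card := by
  by_contra! hle
  have hcard : (B \ T).card ≤ (T \ B).card := by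
    have h₁ := Finset.card_sdiff_add_card_inter B T
    have h₂ := Finset.card_sdiff_add_card_inter T B
    rw [Finset.inter_comm] at h₂
    omega
  have hsum : ∑ y ∈ B \ T, p y ≤ ∑ y ∈ T \ B, p y := calc
    ∑ y ∈ B \ T, p y ≤ (B \ T).card • t := Finset.sum_le_card_nsmul _ _ _ fun y hy =>
      not_lt.1 fun hlt => (Finset.mem_sdiff.1 hy).2 ((hT y).2 hlt)
    _ ≤ (T \ B).card • t := nsmul_le_nsmul_left ht hcard
    _ ≤ ∑ y ∈ T \ B, p y := Finset.card_nsmul_le_sum _ _ _ fun y hy =>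
      ((hT y).1 (Finset.mem_sdiff.1 hy).1).le
  have h₁ := Finset.sum_inter_add_sum_sdiff B T p
  have h₂ := Finset.sum_inter_add_sum_sdiff T B p
  rw [Finset.inter_comm] at h₂
  linarith

theorem cumSpec_succ {Y : Type*} [Fintype Y] {n : ℕ} (p : (Fin n → Y) → ℝ) (δ : ℝ) (K k : ℕ) :
    cumSpec p δ K (k + 1) = cumSpec p δ K k ∪ specSet p δ K (k + 1) := by
  ext y
  simp only [cumSpec, Finset.mem_biUnion, Finset.mem_range, Finset.mem_union]
  constructor
  · rintro ⟨l, hl, hy⟩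
    rcases Nat.lt_succ_iff_lt_or_eq.1 hl with hl | rfl
    · exact Or.inl ⟨l, hl, hy⟩
    · exact Or.inr hy
  · rintro (⟨l, hl, hy⟩ | hy)
    · exact ⟨l, by omega, hy⟩
    · exact ⟨k + 1, by omega, hy⟩

theorem specSet_subset_cumSpec {Y : Type*} [Fintype Y] {n : ℕ} (p : (Fin n → Y) → ℝ) (δ : ℝ)
    (K k : ℕ) : specSet p δ K k ⊆ cumSpec p δ K k :=
  Finset.subset_biUnion_of_mem (fun l => specSet p δ K l) (Finset.self_mem_range_succ k)

theorem cumSpec_zero {Y : Type*} [Fintype Y] {n : ℕ} (p : (Fin n → Y) → ℝ) (δ : ℝ) (K : ℕ) :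
    cumSpec p δ K 0 = specSet p δ K 0 := by
  simp [cumSpec]

theorem mem_cumSpec_of_lt {Y : Type*} [Fintype Y] {n : ℕ} {p : (Fin n → Y) → ℝ}
    (hp : ∀ y, p y ≤ 1) {δ : ℝ} (hδ : 0 ≤ δ) {K k : ℕ} (hk : k < K) (y : Fin n → Y) :
    y ∈ cumSpec p δ K k ↔ (2 : ℝ) ^ (-((n : ℝ) * ((k : ℝ) + 1) * δ)) < p y := by
  induction k with
  | zero => simp [cumSpec_zero, specSet, hk, hp y]
  | succ k ih =>
    have hmono : (2 : ℝ) ^ (-((n : ℝ) * (((k + 1 : ℕ) : ℝ) + 1) * δ)) ≤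
        (2 : ℝ) ^ (-((n : ℝ) * ((k : ℝ) + 1) * δ)) := by
      apply Real.rpow_le_rpow_of_exponent_le one_le_two
      push_cast
      have := mul_nonneg (Nat.cast_nonneg (α := ℝ) n) hδ
      linarith
    rw [cumSpec_succ, Finset.mem_union, ih (by omega), specSet, if_pos hk]
    simp only [Finset.mem_filter_univ]
    push_cast at hmono ⊢
    constructor
    · rintro (h | h)
      · exact hmono.trans_lt h
      · exact h.1
    · intro h
      rcases lt_or_ge ((2 : ℝ) ^ (-((n : ℝ) * ((k : ℝ) + 1) * δ))) (p y) with h' | h'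
      · exact Or.inl h'
      · exact Or.inr ⟨h, h'⟩

theorem mem_cumSpec_self {Y : Type*} [Fintype Y] {n : ℕ} {p : (Fin n → Y) → ℝ}
    (hp : ∀ y, p y ≤ 1) {δ : ℝ} (hδ : 0 ≤ δ) (K : ℕ) {y : Fin n → Y} (hy : 0 < p y) :
    y ∈ cumSpec p δ K K := by
  rcases K with _ | K
  · simp [cumSpec_zero, specSet, hp y, hy]
  · rw [cumSpec_succ, Finset.mem_union, mem_cumSpec_of_lt hp hδ K.lt_succ_self, specSet,
      if_neg (lt_irrefl _)]
    simp only [Finset.mem_filter_univ]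
    push_cast
    rcases lt_or_ge ((2 : ℝ) ^ (-((n : ℝ) * ((K : ℝ) + 1) * δ))) (p y) with h' | h'
    · exact Or.inl h'
    · exact Or.inr ⟨hy, h'⟩

theorem le_upper_of_mem_specSet {Y : Type*} [Fintype Y] {n : ℕ} {p : (Fin n → Y) → ℝ} {δ : ℝ}
    {K k : ℕ} (hk : k ≤ K) {y : Fin n → Y} (hy : y ∈ specSet p δ K k) :
    p y ≤ (2 : ℝ) ^ (-((n : ℝ) * (k : ℝ) * δ)) := by
  unfold specSet at hy
  split_ifs at hy with h
  · exact (Finset.mem_filter.1 hy).2.2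
  · obtain rfl : k = K := by omega
    exact (Finset.mem_filter.1 hy).2.2

theorem logb_card_cumSpec_le {Y : Type*} [Fintype Y] [Nonempty Y] {n : ℕ}
    {p : (Fin n → Y) → ℝ} (hp₀ : ∀ y, 0 ≤ p y) (hp₁ : ∑ y, p y = 1) (hp : ∀ y, p y ≤ 1)
    {δ : ℝ} (hδ : 0 < δ) {k : ℕ} (hk : k ≤ Kdel (Fintype.card Y) δ)
    (hne : (cumSpec p δ (Kdel (Fintype.card Y) δ) k).Nonempty) :
    Real.logb 2 ((cumSpec p δ (Kdel (Fintype.card Y) δ) k).card) ≤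
      (n : ℝ) * (((k : ℝ) + 1) * δ) := by
  set C := cumSpec p δ (Kdel (Fintype.card Y) δ) k
  have hpos : (0 : ℝ) < C.card := by exact_mod_cast hne.card_pos
  rcases hk.lt_or_eq with hlt | heq
  · rw [Real.logb_le_iff_le_rpow one_lt_two hpos]
    have h₁ : (C.card : ℝ) * (2 : ℝ) ^ (-((n : ℝ) * ((k : ℝ) + 1) * δ)) ≤ 1 := by
      rw [← nsmul_eq_mul]
      exact (Finset.card_nsmul_le_sum _ _ _ fun y hy =>
        ((mem_cumSpec_of_lt hp hδ.le hlt y).1 hy).le).trans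
          ((Finset.sum_le_univ_sum_of_nonneg hp₀).trans_eq hp₁)
    rw [Real.rpow_neg zero_le_two, ← div_eq_mul_inv, div_le_one (by positivity)] at h₁
    rwa [← mul_assoc]
  · have hcard : (C.card : ℝ) ≤ (Fintype.card Y : ℝ) ^ n := by
      have := Finset.card_le_univ C
      rw [Fintype.card_fun, Fintype.card_fin] at this
      exact_mod_cast this
    have hK : Real.logb 2 (Fintype.card Y) ≤ (k : ℝ) * δ := by
      rw [← div_le_iff₀ hδ, heq]
      exact Nat.le_ceil _
    calc Real.logb 2 C.card ≤ Real.logb 2 ((Fintype.card Y : ℝ) ^ n) :=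
          Real.logb_le_logb_of_le one_lt_two hpos hcard
      _ = (n : ℝ) * Real.logb 2 (Fintype.card Y) := Real.logb_pow _ _ _
      _ ≤ (n : ℝ) * (((k : ℝ) + 1) * δ) :=
          mul_le_mul_of_nonneg_left (by linarith) (Nat.cast_nonneg n)

theorem le_logb_card_specSet {Y : Type*} [Fintype Y] {n : ℕ} {p : (Fin n → Y) → ℝ} {δ : ℝ}
    {K k : ℕ} (hk : k ≤ K)
    (h : (2 : ℝ) ^ (-((n : ℝ) * δ)) < ∑ y ∈ specSet p δ K k, p y) :
    (n : ℝ) * (((k : ℝ) - 1) * δ) ≤ Real.logb 2 ((specSet p δ K k).card) := by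
  have h₁ : (2 : ℝ) ^ (-((n : ℝ) * δ)) <
      ((specSet p δ K k).card : ℝ) * (2 : ℝ) ^ (-((n : ℝ) * (k : ℝ) * δ)) := by
    refine h.trans_le ?_
    rw [← nsmul_eq_mul]
    exact Finset.sum_le_card_nsmul _ _ _ fun y hy => le_upper_of_mem_specSet hk hy
  have h₂ : (0 : ℝ) < (specSet p δ K k).card :=
    pos_of_mul_pos_left ((by positivity : (0 : ℝ) < 2 ^ (-((n : ℝ) * δ))).trans h₁)
      (by positivity)
  rw [Real.le_logb_iff_rpow_le one_lt_two h₂]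
  rw [← div_lt_iff₀ (by positivity), ← Real.rpow_sub two_pos] at h₁
  refine le_trans (le_of_eq ?_) h₁.le
  congr 1
  ring

theorem gbar_le_card {X Y : Type*} [Fintype Y] {W : X → Y → ℝ} {n : ℕ} {A : Finset (Fin n → X)}
    {η : ℝ} {B : Finset (Fin n → Y)} (hB : η ≤ ∑ y ∈ B, outDist W A y) :
    gbar W A η ≤ B.card :=
  Nat.sInf_le ⟨B, rfl, hB⟩

/-- The minimum defining `gbar` is attained as soon as some quasi-image exists. -/
theorem exists_card_eq_gbar {X Y : Type*} [Fintype Y] {W : X → Y → ℝ} {n : ℕ}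
    {A : Finset (Fin n → X)} {η : ℝ} {B : Finset (Fin n → Y)}
    (hB : η ≤ ∑ y ∈ B, outDist W A y) :
    ∃ C : Finset (Fin n → Y), C.card = gbar W A η ∧ η ≤ ∑ y ∈ C, outDist W A y :=
  Nat.sInf_mem (s := {m | ∃ B : Finset (Fin n → Y), B.card = m ∧ η ≤ ∑ y ∈ B, outDist W A y})
    ⟨_, B, rfl, hB⟩

/-- Lemma 2: for large `n`, `ḡⁿ(A,η)` is bracketed by the sizes of
cumulative unions of the information-spectrum partition sets. -/
theorem stmt_1 {X Y : Type*} [Fintype X] [Fintype Y] [Nonempty X] [Nonempty Y]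
    (W : X → Y → ℝ) (hW : isChannel W)
    (δ : ℝ) (hδ : δ ∈ Set.Ioo (0:ℝ) 1)
    (η : ℝ) (hη : η ∈ Set.Ioc (0:ℝ) 1) :
    ∃ N : ℕ, ∀ n : ℕ, N ≤ n → ∀ A : Finset (Fin n → X), A.Nonempty →
      ∃ k' : ℕ, k' ≤ Kdel (Fintype.card Y) δ ∧
        -- k' is the minimal index with η ≤ η_{k'}
        η ≤ ∑ y ∈ cumSpec (outDist W A) δ (Kdel (Fintype.card Y) δ) k', outDist W A y ∧
        (∀ j < k',
          ∑ y ∈ cumSpec (outDist W A) δ (Kdel (Fintype.card Y) δ) j, outDist W A y < η) ∧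
        -- upper bounds
        (1 / (n:ℝ)) * Real.logb 2 (gbar W A η) ≤
          (1 / (n:ℝ)) *
            Real.logb 2 ((cumSpec (outDist W A) δ (Kdel (Fintype.card Y) δ) k').card) ∧
        (1 / (n:ℝ)) *
            Real.logb 2 ((cumSpec (outDist W A) δ (Kdel (Fintype.card Y) δ) k').card) ≤
          ((k':ℝ) + 2) * δ ∧
        -- lower bounds
        (1 ≤ k' →
          (2:ℝ) ^ (-((n:ℝ) * δ)) <
            ∑ y ∈ specSet (outDist W A) δ (Kdel (Fintype.card Y) δ) (k' - 1),
              outDist W A y →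
          ((k':ℝ) - 2) * δ ≤
            (1 / (n:ℝ)) *
              Real.logb 2 ((specSet (outDist W A) δ (Kdel (Fintype.card Y) δ) (k' - 1)).card) ∧
          (1 / (n:ℝ)) *
              Real.logb 2 ((specSet (outDist W A) δ (Kdel (Fintype.card Y) δ) (k' - 1)).card) ≤
            (1 / (n:ℝ)) * Real.logb 2 (gbar W A η)) := by
  have hδ₀ : 0 < δ := hδ.1
  refine ⟨1, fun n hn A hA => ?_⟩
  have hn₀ : (0 : ℝ) < n := by exact_mod_cast hn
  have hinv : (0 : ℝ) ≤ 1 / (n : ℝ) := by positivity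
  set p := outDist W A
  set K := Kdel (Fintype.card Y) δ
  have hp₀ : ∀ y, 0 ≤ p y := outDist_nonneg hW A
  have hp₁ : ∑ y, p y = 1 := sum_outDist hW hA
  have hp : ∀ y, p y ≤ 1 := fun y =>
    hp₁ ▸ Finset.single_le_sum (fun z _ => hp₀ z) (Finset.mem_univ y)
  have hK : η ≤ ∑ y ∈ cumSpec p δ K K, p y := by
    rw [Finset.sum_subset (Finset.subset_univ _) fun y _ hy => ?_, hp₁]
    · exact hη.2
    · exact le_antisymm (not_lt.1 fun h => hy (mem_cumSpec_self hp hδ₀.le K h)) (hp₀ y)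
  have hex : ∃ k, η ≤ ∑ y ∈ cumSpec p δ K k, p y := ⟨K, hK⟩
  obtain ⟨k, hk, hmin⟩ : ∃ k, η ≤ ∑ y ∈ cumSpec p δ K k, p y ∧
      ∀ j < k, ∑ y ∈ cumSpec p δ K j, p y < η :=
    ⟨Nat.find hex, Nat.find_spec hex, fun j hj => not_le.1 (Nat.find_min hex hj)⟩
  have hkK : k ≤ K := not_lt.1 fun h => (hmin K h).not_ge hK
  have hne_of_mass : ∀ {B : Finset (Fin n → Y)}, η ≤ ∑ y ∈ B, p y → B.Nonempty := fun hB =>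
    Finset.nonempty_of_sum_ne_zero (hη.1.trans_le hB).ne'
  obtain ⟨C, hCcard, hC⟩ := exists_card_eq_gbar hk
  have hg : (0 : ℝ) < gbar W A η := by
    rw [← hCcard]
    exact_mod_cast (hne_of_mass hC).card_pos
  refine ⟨k, hkK, hk, hmin, ?_, ?_, fun hk₁ hmass => ⟨?_, ?_⟩⟩
  · exact mul_le_mul_of_nonneg_left (Real.logb_le_logb_of_le one_lt_two hg
      (by exact_mod_cast gbar_le_card hk)) hinv
  · rw [one_div, inv_mul_le_iff₀ hn₀]
    refine (logb_card_cumSpec_le hp₀ hp₁ hp hδ₀ hkK (hne_of_mass hk)).trans ?_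
    gcongr
    norm_num
  · rw [one_div, le_inv_mul_iff₀ hn₀]
    refine le_trans (le_of_eq ?_) (le_logb_card_specSet (by omega : k - 1 ≤ K) hmass)
    rw [Nat.cast_sub hk₁, Nat.cast_one]
    ring
  · have hpos : (0 : ℝ) < (specSet p δ K (k - 1)).card := by
      exact_mod_cast (Finset.nonempty_of_sum_ne_zero
        ((by positivity : (0 : ℝ) < 2 ^ (-((n : ℝ) * δ))).trans hmass).ne').card_pos
    have hlt : (cumSpec p δ K (k - 1)).card < C.card :=
      card_filter_lt_of_sum_lt (by positivity)
        (mem_cumSpec_of_lt hp hδ₀.le (by omega : k - 1 < K))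
        ((hmin (k - 1) (by omega)).trans_le hC)
    refine mul_le_mul_of_nonneg_left (Real.logb_le_logb_of_le one_lt_two hpos ?_) hinv
    rw [← hCcard]
    exact_mod_cast (Finset.card_le_card (specSet_subset_cumSpec p δ K (k - 1))).trans hlt.le
end

section
/- Fix δ ∈ (0,1), n ≥ 1, a nonempty set A ⊆ 𝒳ⁿ, and η ∈ (0,1]. Let {B_k}_{k=0}^{K_δ} be the δ-information-spectrum partition of 𝒴ⁿ w.r.t. the information spectrum of P_A, set η_k = P_A(⋃_{l=0}^{k} B_l), and let k′ be the minimal index in [0, K_δ] with η ≤ η_{k′}. Then |⋃_{k=0}^{k′−1} B_k| ≤ ḡⁿ(A,η) ≤ |⋃_{k=0}^{k′} B_k| (where the union over an empty index range is the empty set). -/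
open scoped BigOperators Classical
open Finset Real

/-- Union `⋃_{l=0}^{k-1} B_l` of the first `k` sets of the partition
(the empty set when `k = 0`). -/
noncomputable def cumSpecLt {Y : Type*} [Fintype Y] {n : ℕ} (p : (Fin n → Y) → ℝ)
    (δ : ℝ) (K k : ℕ) : Finset (Fin n → Y) :=
  (Finset.range k).biUnion fun l => specSet p δ K l

/-- A transition probability of the `n`-fold product of a channel is at most one. -/
theorem prodW_le_one {X Y : Type*} [Fintype Y] {W : X → Y → ℝ} (hW : isChannel W) {n : ℕ}
    (x : Fin n → X) (y : Fin n → Y) : prodW W x y ≤ 1 :=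
  Finset.prod_le_one (fun j _ => (hW (x j)).1 (y j)) fun j _ => by
    rw [← (hW (x j)).2]
    exact Finset.single_le_sum (fun z _ => (hW (x j)).1 z) (Finset.mem_univ (y j))

theorem outDist_le_one {X Y : Type*} [Fintype Y] {W : X → Y → ℝ} (hW : isChannel W) {n : ℕ}
    (A : Finset (Fin n → X)) (y : Fin n → Y) : outDist W A y ≤ 1 := by
  have h : ∑ x ∈ A, prodW W x y ≤ (A.card : ℝ) := by
    simpa using Finset.sum_le_card_nsmul A (fun x => prodW W x y) 1
      fun x _ => prodW_le_one hW x y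
  calc outDist W A y ≤ (A.card : ℝ)⁻¹ * A.card :=
        mul_le_mul_of_nonneg_left h (by positivity)
    _ ≤ 1 := inv_mul_le_one

/-- The union of the first `k ≤ K` sets of the partition is a superlevel set of `p`. -/
theorem mem_cumSpecLt_iff {Y : Type*} [Fintype Y] {n : ℕ} {p : (Fin n → Y) → ℝ}
    (hp : ∀ y, p y ≤ 1) {δ : ℝ} (hδ : 0 ≤ δ) {K k : ℕ} (hk : k ≤ K) (y : Fin n → Y) :
    y ∈ cumSpecLt p δ K k ↔ (2 : ℝ) ^ (-((n : ℝ) * (k : ℝ) * δ)) < p y := by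
  induction k with
  | zero => simpa [cumSpecLt] using hp y
  | succ k ih =>
    have hstep : y ∈ cumSpecLt p δ K (k + 1) ↔ y ∈ specSet p δ K k ∨ y ∈ cumSpecLt p δ K k := by
      simp [cumSpecLt, Finset.range_add_one]
    have hmono : (2 : ℝ) ^ (-((n : ℝ) * ((k : ℝ) + 1) * δ)) ≤ 2 ^ (-((n : ℝ) * (k : ℝ) * δ)) := by
      apply Real.rpow_le_rpow_of_exponent_le one_le_two
      have : 0 ≤ (n : ℝ) * δ := by positivity
      linarith
    rw [hstep, ih (by lia), specSet, if_pos (by lia)]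
    simp only [Finset.mem_filter, Finset.mem_univ, true_and]
    push_cast
    grind

/-- Among finite sets of at most the same cardinality, a set on which `p` exceeds `t ≥ 0`, and
off which it does not, has maximal sum. -/
theorem sum_le_sum_of_card_le_of_threshold {α : Type*} {p : α → ℝ} {t : ℝ} (ht : 0 ≤ t)
    {B C : Finset α} (hC : ∀ y ∈ C, t ≤ p y) (hC' : ∀ y ∉ C, p y ≤ t)
    (hcard : B.card ≤ C.card) : ∑ y ∈ B, p y ≤ ∑ y ∈ C, p y := by
  have hsdiff : ((B \ C).card : ℝ) ≤ (C \ B).card := by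
    exact_mod_cast Finset.card_sdiff_le_card_sdiff_iff.2 hcard
  rw [← Finset.sum_sdiff_le_sum_sdiff]
  calc ∑ y ∈ B \ C, p y ≤ (B \ C).card * t := by
        simpa using Finset.sum_le_card_nsmul (B \ C) p t
          fun y hy => hC' y (Finset.mem_sdiff.1 hy).2
    _ ≤ (C \ B).card * t := by gcongr
    _ ≤ ∑ y ∈ C \ B, p y := by
        simpa using Finset.card_nsmul_le_sum (C \ B) p t
          fun y hy => hC y (Finset.mem_sdiff.1 hy).1

/-- `|⋃_{k=0}^{k'-1} B_k| ≤ ḡⁿ(A,η) ≤ |⋃_{k=0}^{k'} B_k|` where `k'`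
is the minimal index with `η ≤ η_{k'}`. -/
theorem stmt_3 {X Y : Type*} [Fintype X] [Fintype Y] [Nonempty X] [Nonempty Y]
    (W : X → Y → ℝ) (hW : isChannel W)
    (δ : ℝ) (hδ : δ ∈ Set.Ioo (0:ℝ) 1)
    (n : ℕ) (hn : 1 ≤ n)
    (A : Finset (Fin n → X)) (hA : A.Nonempty)
    (η : ℝ) (hη : η ∈ Set.Ioc (0:ℝ) 1)
    (K : ℕ) (hK : K = Kdel (Fintype.card Y) δ)
    (k' : ℕ) (hk' : k' ≤ K)
    (hmem : η ≤ ∑ y ∈ cumSpecLt (outDist W A) δ K (k' + 1), outDist W A y)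
    (hmin : ∀ j < k', ∑ y ∈ cumSpecLt (outDist W A) δ K (j + 1), outDist W A y < η) :
    (cumSpecLt (outDist W A) δ K k').card ≤ gbar W A η ∧
    gbar W A η ≤ (cumSpecLt (outDist W A) δ K (k' + 1)).card := by
  refine ⟨?_, Nat.sInf_le ⟨_, rfl, hmem⟩⟩
  have hmemC := mem_cumSpecLt_iff (outDist_le_one hW A) hδ.1.le hk'
  refine le_csInf ⟨_, _, rfl, hmem⟩ ?_
  rintro m ⟨B, rfl, hB⟩
  by_contra! hlt
  obtain _ | j := k'
  · simp [cumSpecLt] at hlt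
  · refine ((hB.trans ?_).trans_lt (hmin j j.lt_succ_self)).false
    exact sum_le_sum_of_card_le_of_threshold (Real.rpow_nonneg zero_le_two _)
      (fun y hy => ((hmemC y).1 hy).le) (fun y hy => not_lt.1 (mt (hmemC y).2 hy)) hlt.le
end

section
/- Fix the channel W and α′ ∈ (0,1). For any sequence (α_n) with α_n ∈ (0, α′] for all n and (−log₂ α_n)/n → 0 as n → ∞, there exist sequences β_n ∈ (0,1) with β_n → 1 and τ_n ≥ 0 with τ_n → 0 such that for all sufficiently large n and every nonempty A′ ⊆ 𝒳ⁿ: 0 ≤ (1/n)·log₂ gⁿ(A′, β_n) − (1/n)·log₂ gⁿ(A′, α_n) ≤ τ_n. -/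
open scoped BigOperators Classical
open Finset Real

/-- Kantorovich's inequality for a finite distribution and a function of ratio at most `u`. -/
lemma sum_mul_sum_inv_le {Y : Type*} [Fintype Y] [Nonempty Y] (p G : Y → ℝ) (u : ℝ)
    (hp : ∀ y, 0 ≤ p y) (hp1 : ∑ y, p y = 1) (hG : ∀ y, 0 < G y)
    (hu : ∀ y z, G y ≤ u * G z) :
    (∑ y, p y * G y) * (∑ y, p y * (G y)⁻¹) ≤ (1 + u) ^ 2 / (4 * u) := by
  obtain ⟨w, -, hw⟩ := Finset.exists_min_image Finset.univ G Finset.univ_nonempty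
  set m := G w with hm
  have hm0 : 0 < m := hG w
  have hu0 : 0 < u := by
    have := hu w w
    nlinarith
  set a := ∑ y, p y * G y with ha
  have ha0 : 0 ≤ a := Finset.sum_nonneg fun y _ => mul_nonneg (hp y) (hG y).le
  have hb : ∑ y, p y * (G y)⁻¹ ≤ ((1 + u) * m - a) / (u * m ^ 2) := by
    have h1 : ∀ y, p y * (G y)⁻¹ ≤ ((1 + u) * m * p y - p y * G y) / (u * m ^ 2) := by
      intro y
      have h2 : (G y)⁻¹ ≤ ((1 + u) * m - G y) / (u * m ^ 2) := by
        rw [inv_eq_one_div, div_le_div_iff₀ (hG y) (by positivity)]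
        nlinarith [mul_nonneg (sub_nonneg.2 (hw y (Finset.mem_univ y)))
          (sub_nonneg.2 (hu y w))]
      calc p y * (G y)⁻¹ ≤ p y * (((1 + u) * m - G y) / (u * m ^ 2)) :=
            mul_le_mul_of_nonneg_left h2 (hp y)
        _ = _ := by ring
    calc ∑ y, p y * (G y)⁻¹
        ≤ ∑ y, ((1 + u) * m * p y - p y * G y) / (u * m ^ 2) :=
          Finset.sum_le_sum fun y _ => h1 y
      _ = _ := by
          rw [← Finset.sum_div, Finset.sum_sub_distrib, ← Finset.mul_sum, hp1, mul_one]
  calc a * ∑ y, p y * (G y)⁻¹ ≤ a * (((1 + u) * m - a) / (u * m ^ 2)) :=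
        mul_le_mul_of_nonneg_left hb ha0
    _ = (a * ((1 + u) * m - a)) / (u * m ^ 2) := by ring
    _ ≤ _ := by
        rw [div_le_div_iff₀ (by positivity) (by positivity)]
        nlinarith [mul_nonneg hu0.le (sq_nonneg ((1 + u) * m - 2 * a))]

lemma sum_prod_cons {Y : Type*} [Fintype Y] {n : ℕ} (p : Fin (n + 1) → Y → ℝ)
    (F : (Fin (n + 1) → Y) → ℝ) :
    ∑ y, (∏ j, p j (y j)) * F y =
      ∑ a, p 0 a * ∑ x : Fin n → Y, (∏ j, p j.succ (x j)) * F (Fin.cons a x) := by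
  rw [← (Fin.consEquiv fun _ : Fin (n + 1) => Y).sum_comp, Fintype.sum_prod_type]
  refine Finset.sum_congr rfl fun a _ => ?_
  rw [Finset.mul_sum]
  refine Finset.sum_congr rfl fun x _ => ?_
  simp [Fin.consEquiv, Fin.prod_univ_succ, mul_assoc]

lemma hammingDist_cons {Y : Type*} {n : ℕ} (a b : Y) (x z : Fin n → Y) :
    hammingDist (Fin.cons a x : Fin (n + 1) → Y) (Fin.cons b z) =
      (if a ≠ b then 1 else 0) + hammingDist x z := by
  simp only [hammingDist, Finset.card_filter, Fin.sum_univ_succ, Fin.cons_zero, Fin.cons_succ]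

/-- Tensorized Kantorovich inequality for functions whose logarithm is Lipschitz
with respect to the Hamming distance. -/
lemma sum_mul_sum_inv_le_pow {Y : Type*} [Fintype Y] [Nonempty Y] (u : ℝ) (hu_one : 1 ≤ u) :
    ∀ (n : ℕ) (p : Fin n → Y → ℝ) (F : (Fin n → Y) → ℝ),
      (∀ j y, 0 ≤ p j y) → (∀ j, ∑ y, p j y = 1) → (∀ y, 0 < F y) →
      (∀ y z, F y ≤ u ^ hammingDist y z * F z) →
      (∑ y, (∏ j, p j (y j)) * F y) * (∑ y, (∏ j, p j (y j)) * (F y)⁻¹) ≤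
        ((1 + u) ^ 2 / (4 * u)) ^ n := by
  intro n
  induction n with
  | zero =>
    intro p F _ _ hF _
    simp [(hF _).ne']
  | succ n ih =>
    intro p F hp hp1 hF hu
    have hprod : ∀ x : Fin n → Y, 0 ≤ ∏ j, p j.succ (x j) :=
      fun x => Finset.prod_nonneg fun j _ => hp _ _
    have hsum : ∑ x : Fin n → Y, ∏ j, p j.succ (x j) = 1 := by
      rw [← Fintype.prod_sum]
      simp [hp1]
    rw [sum_prod_cons, sum_prod_cons]
    set G : Y → ℝ := fun a => ∑ x : Fin n → Y, (∏ j, p j.succ (x j)) * F (Fin.cons a x) with hGdef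
    have hG : ∀ a, 0 < G a := by
      intro a
      obtain ⟨x, -, hx⟩ : ∃ x ∈ (Finset.univ : Finset (Fin n → Y)),
          0 < ∏ j, p j.succ (x j) := by
        apply Finset.exists_lt_of_sum_lt
        rw [hsum]
        simp
      exact Finset.sum_pos' (fun x _ => mul_nonneg (hprod x) (hF _).le)
        ⟨x, Finset.mem_univ x, mul_pos hx (hF _)⟩
    have hu1 : ∀ a b, G a ≤ u * G b := by
      intro a b
      simp only [hGdef]
      rw [Finset.mul_sum]
      refine Finset.sum_le_sum fun x _ => ?_
      have h1 : F (Fin.cons a x) ≤ u * F (Fin.cons b x) := by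
        refine (hu _ (Fin.cons b x)).trans (mul_le_mul_of_nonneg_right ?_ (hF _).le)
        rw [hammingDist_cons, hammingDist_self]
        split_ifs <;> simp [hu_one]
      calc _ ≤ (∏ j, p j.succ (x j)) * (u * F (Fin.cons b x)) :=
            mul_le_mul_of_nonneg_left h1 (hprod x)
        _ = _ := by ring
    have hGinv : ∀ a, ∑ x : Fin n → Y, (∏ j, p j.succ (x j)) * (F (Fin.cons a x))⁻¹ ≤
        ((1 + u) ^ 2 / (4 * u)) ^ n * (G a)⁻¹ := by
      intro a
      rw [← div_eq_mul_inv, le_div_iff₀ (hG a), mul_comm]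
      refine ih (fun j => p j.succ) (fun x => F (Fin.cons a x)) (fun j => hp _)
        (fun j => hp1 _) (fun x => hF _) fun x z => ?_
      have := hu (Fin.cons a x) (Fin.cons a z)
      simpa [hammingDist_cons] using this
    have hGsum : 0 ≤ ∑ a, p 0 a * G a :=
      Finset.sum_nonneg fun a _ => mul_nonneg (hp _ _) (hG a).le
    calc (∑ a, p 0 a * G a) *
          ∑ a, p 0 a * ∑ x : Fin n → Y, (∏ j, p j.succ (x j)) * (F (Fin.cons a x))⁻¹
        ≤ (∑ a, p 0 a * G a) *
          ∑ a, p 0 a * (((1 + u) ^ 2 / (4 * u)) ^ n * (G a)⁻¹) := by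
          gcongr with a _
          · exact hp 0 a
          · exact hGinv a
      _ = ((1 + u) ^ 2 / (4 * u)) ^ n *
          ((∑ a, p 0 a * G a) * ∑ a, p 0 a * (G a)⁻¹) := by
          rw [mul_left_comm, Finset.mul_sum Finset.univ _ (((1 + u) ^ 2 / (4 * u)) ^ n)]
          congr 2
          exact funext fun a => mul_left_comm _ _ _
      _ ≤ ((1 + u) ^ 2 / (4 * u)) ^ n * ((1 + u) ^ 2 / (4 * u)) := by
          gcongr
          exact sum_mul_sum_inv_le (p 0) G u (hp 0) (hp1 0) hG hu1
      _ = _ := (pow_succ _ _).symm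

lemma kantorovich_const_le_exp (t : ℝ) :
    (1 + exp t) ^ 2 / (4 * exp t) ≤ exp (t ^ 2 / 4) := by
  have h : (1 + exp t) ^ 2 / (4 * exp t) = cosh (t / 2) ^ 2 := by
    have h1 : exp t = exp (t / 2) ^ 2 := by rw [← exp_nat_mul]; congr 1; push_cast; ring
    rw [cosh_eq, exp_neg, h1]
    have := (exp_pos (t / 2)).ne'
    field_simp
    ring
  rw [h]
  calc cosh (t / 2) ^ 2 ≤ exp ((t / 2) ^ 2 / 2) ^ 2 := by
        have := cosh_pos (t / 2)
        gcongr
        exact cosh_le_exp_half_sq _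
    _ = _ := by rw [← exp_nat_mul]; congr 1; push_cast; ring

/-- The closed Hamming neighbourhood of radius `r` of the set `B`. -/
noncomputable def hammingNhd {Y : Type*} [Fintype Y] {n : ℕ} (B : Finset (Fin n → Y)) (r : ℝ) :
    Finset (Fin n → Y) :=
  Finset.univ.filter fun y => ∃ z ∈ B, (hammingDist y z : ℝ) ≤ r

/-- Blowing-up lemma: the measure of the complement of a Hamming neighbourhood. -/
lemma sum_compl_hammingNhd_le {Y : Type*} [Fintype Y] [Nonempty Y] {n : ℕ}
    (p : Fin n → Y → ℝ) (hp : ∀ j y, 0 ≤ p j y) (hp1 : ∀ j, ∑ y, p j y = 1)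
    (B : Finset (Fin n → Y)) (a : ℝ) (ha : 0 < a) (hB : a ≤ ∑ y ∈ B, ∏ j, p j (y j))
    (t r : ℝ) (ht : 0 ≤ t) :
    ∑ y ∈ (hammingNhd B r)ᶜ, ∏ j, p j (y j) ≤ exp (n * (t ^ 2 / 4) - t * r) / a := by
  have hBne : B.Nonempty := by
    rw [Finset.nonempty_iff_ne_empty]
    rintro rfl
    simp at hB
    linarith
  have hprod : ∀ y : Fin n → Y, 0 ≤ ∏ j, p j (y j) :=
    fun y => Finset.prod_nonneg fun j _ => hp _ _
  set F : (Fin n → Y) → ℝ := fun y => B.inf' hBne fun z => exp t ^ hammingDist y z with hFdef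
  have hF : ∀ y, 0 < F y := by
    intro y
    simp only [hFdef, Finset.lt_inf'_iff]
    intro z _
    positivity
  have hu_one : 1 ≤ exp t := one_le_exp ht
  have hlip : ∀ y z, F y ≤ exp t ^ hammingDist y z * F z := by
    intro y z
    obtain ⟨w, hwB, hw⟩ := Finset.exists_mem_eq_inf' hBne fun w => exp t ^ hammingDist z w
    have h1 : F z = exp t ^ hammingDist z w := hw
    rw [h1, ← pow_add]
    exact (Finset.inf'_le _ hwB).trans (pow_le_pow_right₀ hu_one (hammingDist_triangle y z w))
  have hmain := (sum_mul_sum_inv_le_pow (exp t) hu_one n p F hp hp1 hF hlip).trans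
    (pow_le_pow_left₀ (by positivity) (kantorovich_const_le_exp t) n)
  have hinv : a ≤ ∑ y, (∏ j, p j (y j)) * (F y)⁻¹ := by
    refine hB.trans ((Finset.sum_le_sum fun y hy => ?_).trans
      (Finset.sum_le_univ_sum_of_nonneg fun y => mul_nonneg (hprod y) (inv_nonneg.2 (hF y).le)))
    refine le_mul_of_one_le_right (hprod y) ((one_le_inv₀ (hF y)).2 ?_)
    refine (Finset.inf'_le _ hy).trans ?_
    simp
  have hge : exp (t * r) * ∑ y ∈ (hammingNhd B r)ᶜ, ∏ j, p j (y j) ≤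
      ∑ y, (∏ j, p j (y j)) * F y := by
    rw [Finset.mul_sum]
    refine (Finset.sum_le_sum fun y hy => ?_).trans
      (Finset.sum_le_univ_sum_of_nonneg fun y => mul_nonneg (hprod y) (hF y).le)
    rw [mul_comm]
    refine mul_le_mul_of_nonneg_left ?_ (hprod y)
    simp only [hFdef, Finset.le_inf'_iff]
    intro z hz
    rw [← exp_nat_mul, mul_comm]
    simp only [hammingNhd, Finset.mem_compl, Finset.mem_filter, Finset.mem_univ, true_and,
      not_exists, not_and, not_le] at hy
    exact exp_le_exp.2 (mul_le_mul_of_nonneg_right (hy z hz).le ht)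
  have hS : 0 ≤ ∑ y ∈ (hammingNhd B r)ᶜ, ∏ j, p j (y j) :=
    Finset.sum_nonneg fun y _ => hprod y
  rw [le_div_iff₀ ha, exp_sub, le_div_iff₀ (exp_pos _), exp_nat_mul]
  refine le_trans ?_ hmain
  calc _ = (exp (t * r) * ∑ y ∈ (hammingNhd B r)ᶜ, ∏ j, p j (y j)) * a := by ring
    _ ≤ _ := mul_le_mul hge hinv ha.le (le_trans (by positivity) hge)

lemma card_hammingBall_le {Y : Type*} [Fintype Y] {n : ℕ} (z : Fin n → Y) (l r : ℝ)
    (hl : 0 < l) :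
    ((Finset.univ.filter fun y : Fin n → Y => (hammingDist y z : ℝ) ≤ r).card : ℝ) ≤
      exp (l * r + n * (Fintype.card Y / l)) := by
  have h1 : ∀ y : Fin n → Y, exp (-l * hammingDist y z) =
      ∏ j, (if y j ≠ z j then exp (-l) else 1) := by
    intro y
    rw [Finset.prod_ite, Finset.prod_const, Finset.prod_const_one, mul_one, mul_comm,
      exp_nat_mul]
    rfl
  have h2 : ∀ b : Y, ∑ c : Y, (if c ≠ b then exp (-l) else 1) ≤ exp (Fintype.card Y / l) := by
    intro b
    have h3 : exp (-l) ≤ 1 / l := by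
      rw [exp_neg, inv_eq_one_div]
      exact one_div_le_one_div_of_le hl (by linarith [add_one_le_exp l])
    calc ∑ c : Y, (if c ≠ b then exp (-l) else 1)
        ≤ ∑ c : Y, (1 / l + if c = b then 1 else 0) := by
          refine Finset.sum_le_sum fun c _ => ?_
          have : 0 < 1 / l := by positivity
          by_cases hc : c = b
          · simp [hc, hl.le]
          · simpa [hc] using h3
      _ = Fintype.card Y / l + 1 := by
          rw [Finset.sum_add_distrib]
          simp [div_eq_mul_inv]
      _ ≤ _ := add_one_le_exp _
  calc ((Finset.univ.filter fun y : Fin n → Y => (hammingDist y z : ℝ) ≤ r).card : ℝ)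
      = ∑ y ∈ Finset.univ.filter (fun y : Fin n → Y => (hammingDist y z : ℝ) ≤ r), (1 : ℝ) := by
        simp
    _ ≤ ∑ y ∈ Finset.univ.filter (fun y : Fin n → Y => (hammingDist y z : ℝ) ≤ r),
          exp (l * r) * exp (-l * hammingDist y z) := by
        refine Finset.sum_le_sum fun y hy => ?_
        rw [← exp_add]
        have := (Finset.mem_filter.1 hy).2
        exact one_le_exp (by nlinarith)
    _ ≤ ∑ y : Fin n → Y, exp (l * r) * exp (-l * hammingDist y z) :=
        Finset.sum_le_univ_sum_of_nonneg fun y => by positivity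
    _ = exp (l * r) * ∏ j, ∑ c : Y, (if c ≠ z j then exp (-l) else 1) := by
        rw [← Finset.mul_sum, Fintype.prod_sum]
        simp only [h1]
    _ ≤ exp (l * r) * ∏ _j : Fin n, exp (Fintype.card Y / l) := by
        gcongr with j _
        exact h2 _
    _ = _ := by
        rw [exp_add, exp_nat_mul]
        simp

lemma card_hammingNhd_le {Y : Type*} [Fintype Y] {n : ℕ} (B : Finset (Fin n → Y)) (l r : ℝ)
    (hl : 0 < l) :
    ((hammingNhd B r).card : ℝ) ≤ B.card * exp (l * r + n * (Fintype.card Y / l)) := by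
  have h : hammingNhd B r =
      B.biUnion fun z => Finset.univ.filter fun y => (hammingDist y z : ℝ) ≤ r := by
    ext y
    simp [hammingNhd]
  rw [h]
  calc _ ≤ ((∑ z ∈ B, (Finset.univ.filter fun y : Fin n → Y =>
          (hammingDist y z : ℝ) ≤ r).card : ℕ) : ℝ) := by
        exact_mod_cast Finset.card_biUnion_le
    _ ≤ _ := by
        push_cast
        rw [← nsmul_eq_mul]
        exact Finset.sum_le_card_nsmul _ _ _ fun z _ => card_hammingBall_le z l r hl

lemma prodWSet_univ {X Y : Type*} [Fintype Y] {W : X → Y → ℝ} (hW : isChannel W) {n : ℕ}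
    (x : Fin n → X) : prodWSet W x Finset.univ = 1 := by
  simp only [prodWSet, prodW]
  rw [← Fintype.prod_sum fun j c => W (x j) c]
  simp [(hW _).2]

lemma exists_card_eq_gimg {X Y : Type*} [Fintype Y] {W : X → Y → ℝ} (hW : isChannel W) {n : ℕ}
    (A : Finset (Fin n → X)) {η : ℝ} (hη : η ≤ 1) :
    ∃ B : Finset (Fin n → Y), B.card = gimg W A η ∧ ∀ x ∈ A, η ≤ prodWSet W x B :=
  Nat.sInf_mem (s := {m | ∃ B : Finset (Fin n → Y), B.card = m ∧ ∀ x ∈ A, η ≤ prodWSet W x B})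
    ⟨_, Finset.univ, rfl, fun x _ => by rw [prodWSet_univ hW x]; exact hη⟩

lemma gimg_le_card {X Y : Type*} [Fintype Y] (W : X → Y → ℝ) {n : ℕ}
    (A : Finset (Fin n → X)) {η : ℝ} (B : Finset (Fin n → Y))
    (hB : ∀ x ∈ A, η ≤ prodWSet W x B) : gimg W A η ≤ B.card :=
  Nat.sInf_le ⟨B, rfl, hB⟩

lemma gimg_mono {X Y : Type*} [Fintype Y] {W : X → Y → ℝ} (hW : isChannel W) {n : ℕ}
    (A : Finset (Fin n → X)) {a b : ℝ} (hab : a ≤ b) (hb : b ≤ 1) :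
    gimg W A a ≤ gimg W A b := by
  obtain ⟨B, hBc, hB⟩ := exists_card_eq_gimg hW A hb
  rw [← hBc]
  exact gimg_le_card W A B fun x hx => hab.trans (hB x hx)

lemma gimg_pos {X Y : Type*} [Fintype Y] {W : X → Y → ℝ} (hW : isChannel W) {n : ℕ}
    {A : Finset (Fin n → X)} (hA : A.Nonempty) {a : ℝ} (ha : 0 < a) (ha1 : a ≤ 1) :
    0 < gimg W A a := by
  obtain ⟨B, hBc, hB⟩ := exists_card_eq_gimg hW A ha1
  obtain ⟨x, hx⟩ := hA
  rw [← hBc, Finset.card_pos, Finset.nonempty_iff_ne_empty]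
  rintro rfl
  have := hB x hx
  simp [prodWSet] at this
  linarith

/-- Blowing up an `a`-image gives a `b`-image of comparable size. -/
lemma gimg_le_mul_exp {X Y : Type*} [Fintype Y] [Nonempty Y] {W : X → Y → ℝ}
    (hW : isChannel W) {n : ℕ} (A : Finset (Fin n → X)) {a b t l r : ℝ} (ha : 0 < a)
    (ha1 : a ≤ 1) (ht : 0 ≤ t) (hl : 0 < l)
    (hb : exp (n * (t ^ 2 / 4) - t * r) / a ≤ 1 - b) :
    (gimg W A b : ℝ) ≤ gimg W A a * exp (l * r + n * (Fintype.card Y / l)) := by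
  obtain ⟨B, hBc, hB⟩ := exists_card_eq_gimg hW A ha1
  rw [← hBc]
  refine le_trans ?_ (card_hammingNhd_le B l r hl)
  refine Nat.cast_le.2 (gimg_le_card W A _ fun x hx => ?_)
  have h1 := sum_compl_hammingNhd_le (fun j => W (x j)) (fun j => (hW _).1) (fun j => (hW _).2)
    B a ha (hB x hx) t r ht
  have h2 : prodWSet W x (hammingNhd B r) + ∑ y ∈ (hammingNhd B r)ᶜ, prodW W x y = 1 := by
    rw [← prodWSet_univ hW x]
    exact Finset.sum_add_sum_compl _ _
  have h3 : ∑ y ∈ (hammingNhd B r)ᶜ, prodW W x y ≤ exp (n * (t ^ 2 / 4) - t * r) / a := h1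
  linarith


open Filter in
/-- Lemma 3, sequence version: for `α_n ∈ (0,α']` with
`(-log₂ α_n)/n → 0`, there are `β_n → 1` and `τ_n → 0` such that eventually, for every
nonempty `A'`, `0 ≤ (1/n) log₂ gⁿ(A',β_n) - (1/n) log₂ gⁿ(A',α_n) ≤ τ_n`. -/
theorem stmt_4 {X Y : Type*} [Fintype X] [Fintype Y] [Nonempty X] [Nonempty Y]
    (W : X → Y → ℝ) (hW : isChannel W)
    (α' : ℝ) (hα' : α' ∈ Set.Ioo (0:ℝ) 1)
    (α : ℕ → ℝ) (hα : ∀ n, α n ∈ Set.Ioc (0:ℝ) α')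
    (hαlim : Tendsto (fun n : ℕ => -Real.logb 2 (α n) / (n:ℝ)) atTop (nhds 0)) :
    ∃ β τ : ℕ → ℝ,
      (∀ n, β n ∈ Set.Ioo (0:ℝ) 1) ∧ Tendsto β atTop (nhds 1) ∧
      (∀ n, 0 ≤ τ n) ∧ Tendsto τ atTop (nhds 0) ∧
      ∃ N : ℕ, ∀ n : ℕ, N ≤ n → ∀ A' : Finset (Fin n → X), A'.Nonempty →
        0 ≤ (1 / (n:ℝ)) * Real.logb 2 (gimg W A' (β n)) -
              (1 / (n:ℝ)) * Real.logb 2 (gimg W A' (α n)) ∧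
        (1 / (n:ℝ)) * Real.logb 2 (gimg W A' (β n)) -
              (1 / (n:ℝ)) * Real.logb 2 (gimg W A' (α n)) ≤ τ n := by
  set c : ℝ := (Fintype.card Y : ℝ) with hc
  set e : ℕ → ℝ := fun n => -Real.logb 2 (α n) / (n : ℝ) with he
  set s : ℕ → ℝ := fun n => √(4 * (e n * Real.log 2 + 1 / √(n : ℝ))) with hs
  have hroot : Tendsto (fun n : ℕ => √(n : ℝ)) atTop atTop :=
    tendsto_sqrt_atTop.comp tendsto_natCast_atTop_atTop
  have hs0 : Tendsto s atTop (nhds 0) := by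
    have h1 : Tendsto (fun n : ℕ => 1 / √(n : ℝ)) atTop (nhds 0) := by
      simp only [one_div]
      exact hroot.inv_tendsto_atTop
    have h2 := (((hαlim.mul_const (Real.log 2)).add h1).const_mul 4).sqrt
    simpa only [zero_mul, add_zero, mul_zero, Real.sqrt_zero] using h2
  have hβ : Tendsto (fun n : ℕ => 1 - exp (-√(n : ℝ) - 1)) atTop (nhds 1) := by
    have h1 : Tendsto (fun n : ℕ => -√(n : ℝ) - 1) atTop atBot := by
      have := tendsto_atBot_add_const_right atTop (-1 : ℝ) (tendsto_neg_atTop_atBot.comp hroot)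
      simpa [sub_eq_add_neg, Function.comp_def] using this
    simpa using (tendsto_exp_atBot.comp h1).const_sub 1
  have hlog2 : 0 < Real.log 2 := Real.log_pos one_lt_two
  refine ⟨fun n => 1 - exp (-√(n : ℝ) - 1), fun n => (1 + c) * √(s n) / Real.log 2, ?_, hβ,
    fun n => by positivity, ?_, ?_⟩
  · intro n
    have h1 : exp (-√(n : ℝ) - 1) < 1 := by
      rw [exp_lt_one_iff]
      linarith [Real.sqrt_nonneg (n : ℝ)]
    exact ⟨by linarith, by linarith [exp_pos (-√(n : ℝ) - 1)]⟩
  · simpa using (hs0.sqrt.const_mul (1 + c)).div_const (Real.log 2)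
  obtain ⟨N, hN⟩ := eventually_atTop.1 ((hβ.eventually (eventually_ge_nhds hα'.2)).and
    (eventually_ge_atTop 1))
  refine ⟨N, fun n hn A' hA => ?_⟩
  obtain ⟨hβn, hn1⟩ := hN n hn
  obtain ⟨hα0, hαα'⟩ := hα n
  set b := 1 - exp (-√(n : ℝ) - 1) with hb
  have hb1 : b ≤ 1 := by linarith [exp_pos (-√(n : ℝ) - 1)]
  have hα1 : α n ≤ 1 := hαα'.trans hα'.2.le
  have hn0 : (0 : ℝ) < n := by exact_mod_cast hn1
  have hroot1 : 1 ≤ √(n : ℝ) := by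
    rw [Real.one_le_sqrt]
    exact_mod_cast hn1
  have hen : (n : ℝ) * (e n * Real.log 2) = -Real.log (α n) := by
    simp only [he, Real.logb]
    field_simp
  have he0 : 0 ≤ e n * Real.log 2 := by
    have h1 : 0 ≤ (n : ℝ) * (e n * Real.log 2) := by
      rw [hen]
      linarith [Real.log_nonpos hα0.le hα1]
    exact nonneg_of_mul_nonneg_right h1 hn0
  have hspos : 0 < s n := by
    simp only [hs]
    positivity
  have hssq : s n ^ 2 = 4 * (e n * Real.log 2 + 1 / √(n : ℝ)) := by
    simp only [hs]
    exact Real.sq_sqrt (by positivity)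
  have hnroot : (n : ℝ) * (1 / √(n : ℝ)) = √(n : ℝ) := by
    rw [mul_one_div, Real.div_sqrt]
  have hblow : exp (n * (s n ^ 2 / 4) - s n * (n * s n)) / α n ≤ 1 - b := by
    have h1 : exp (n * (s n ^ 2 / 4) - s n * (n * s n)) / α n =
        exp (n * (s n ^ 2 / 4) - s n * (n * s n) - Real.log (α n)) := by
      rw [exp_sub _ (Real.log (α n)), Real.exp_log hα0]
    have h2 : (n : ℝ) * (s n ^ 2 / 4) - s n * (n * s n) =
        -3 * (n * (e n * Real.log 2) + n * (1 / √(n : ℝ))) := by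
      have : (n : ℝ) * (s n ^ 2 / 4) - s n * (n * s n) = -3 / 4 * n * s n ^ 2 := by ring
      rw [this, hssq]
      ring
    rw [h1, h2, hen, hnroot, hb, sub_sub_cancel]
    refine exp_le_exp.2 ?_
    linarith [Real.log_nonpos hα0.le hα1]
  have hle := gimg_le_mul_exp hW A' hα0 hα1 hspos.le (inv_pos.2 (Real.sqrt_pos.2 hspos)) hblow
  have hga : (0 : ℝ) < gimg W A' (α n) := by exact_mod_cast gimg_pos hW hA hα0 hα1
  have hmono : (gimg W A' (α n) : ℝ) ≤ gimg W A' b :=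
    Nat.cast_le.2 (gimg_mono hW A' (hαα'.trans hβn) hb1)
  constructor
  · rw [← mul_sub]
    exact mul_nonneg (by positivity)
      (sub_nonneg.2 (Real.logb_le_logb_of_le one_lt_two hga hmono))
  · have h1 := Real.log_le_log (hga.trans_le hmono) hle
    rw [Real.log_mul hga.ne' (exp_pos _).ne', Real.log_exp] at h1
    have h2 : (√(s n))⁻¹ * (n * s n) + n * (Fintype.card Y / (√(s n))⁻¹) =
        n * ((1 + c) * √(s n)) := by
      rw [div_inv_eq_mul, mul_left_comm, inv_mul_eq_div, Real.div_sqrt]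
      ring
    rw [h2] at h1
    rw [← mul_sub, Real.logb, Real.logb, ← sub_div, one_div_mul_eq_div, div_div,
      div_le_div_iff₀ (by positivity) hlog2]
    calc _ ≤ (n * ((1 + c) * √(s n))) * Real.log 2 := by gcongr; linarith
      _ = _ := by ring
end
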